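/- Let n ≥ 2, let 𝔻 be the parabolic dyadic grid on ℝ^{n-1} × ℝ, let 𝐒* ⊆ 𝔻 be a semi-coherent stopping time regime with maximal cube Q(𝐒*), and let ℬ ⊆ 𝐒* satisfy the Carleson packing condition Σ_{Q ∈ ℬ, Q ⊆ P} |Q| ≤ C''|P| for all P ∈ 𝔻, for some constant C'' > 0. If 𝐒* ∖ ℬ is nonempty, then it can be partitioned into countably many pairwise disjoint semi-coherent stopping time regimes {𝐒_j}_j whose maximal cubes pack: Σ_{j : Q(𝐒_j) ⊆ P} |Q(𝐒_j)| ≤ (2 + C'') |P| for every P ∈ 𝔻. -/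

import Mathlib

open MeasureTheory

/-- A parabolic dyadic cube of the grid `𝔻` on `ℝ^m × ℝ`, recorded by its parameters. -/
structure PCube (m : ℕ) where
  k : ℤ
  v : Fin m → ℤ
  j : ℤ

/-- The underlying set of a parabolic dyadic cube. -/
def PCube.carrier {m : ℕ} (Q : PCube m) : Set (EuclideanSpace ℝ (Fin m) × ℝ) :=
  {p | (∀ i, p.1 i ∈ Set.Ico ((2 : ℝ) ^ (-Q.k) * Q.v i) ((2 : ℝ) ^ (-Q.k) * (Q.v i + 1))) ∧
    p.2 ∈ Set.Ico ((4 : ℝ) ^ (-Q.k) * Q.j) ((4 : ℝ) ^ (-Q.k) * (Q.j + 1))}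

/-- `𝐒` is a semi-coherent stopping time regime with maximal cube `Qmax`. -/
def SemiCoherent {m : ℕ} (S : Set (PCube m)) (Qmax : PCube m) : Prop :=
  Qmax ∈ S ∧ (∀ Q ∈ S, Q.carrier ⊆ Qmax.carrier) ∧
    ∀ Q' ∈ S, ∀ Qstar ∈ S, ∀ Q : PCube m,
      Q'.carrier ⊆ Q.carrier → Q.carrier ⊆ Qstar.carrier → Q ∈ S

/-- The dyadic parent of a parabolic dyadic cube. -/
def PCube.parent {m : ℕ} (Q : PCube m) : PCube m :=
  ⟨Q.k - 1, fun i => Q.v i / 2, Q.j / 4⟩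

/-- The cube of generation `k` containing the point `p`. -/
noncomputable def PCube.ofPoint {m : ℕ} (k : ℤ) (p : EuclideanSpace ℝ (Fin m) × ℝ) : PCube m :=
  ⟨k, fun i => ⌊(2 : ℝ) ^ k * p.1 i⌋, ⌊(4 : ℝ) ^ k * p.2⌋⟩

namespace PCube

variable {m : ℕ}

theorem mem_Ico_zpow_iff {a : ℝ} (ha : 0 < a) (k z : ℤ) (x : ℝ) :
    x ∈ Set.Ico (a ^ (-k) * z) (a ^ (-k) * (z + 1)) ↔ z = ⌊a ^ k * x⌋ := by
  have hk : 0 < a ^ k := zpow_pos ha k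
  rw [eq_comm, Int.floor_eq_iff, Set.mem_Ico, zpow_neg, inv_mul_le_iff₀ hk, lt_inv_mul_iff₀ hk]

theorem mem_carrier_iff {Q : PCube m} {p : EuclideanSpace ℝ (Fin m) × ℝ} :
    p ∈ Q.carrier ↔ Q = PCube.ofPoint Q.k p := by
  obtain ⟨k, v, j⟩ := Q
  simp only [carrier, Set.mem_ofPred_eq, mem_Ico_zpow_iff (two_pos : (0 : ℝ) < 2),
    mem_Ico_zpow_iff (four_pos : (0 : ℝ) < 4), PCube.ofPoint, PCube.mk.injEq, true_and, funext_iff]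

theorem parent_ofPoint (k : ℤ) (p : EuclideanSpace ℝ (Fin m) × ℝ) :
    (PCube.ofPoint k p).parent = PCube.ofPoint (k - 1) p := by
  have h2 : ∀ x : ℝ, ⌊(2 : ℝ) ^ k * x⌋ / 2 = ⌊(2 : ℝ) ^ (k - 1) * x⌋ := fun x => by
    rw [zpow_sub_one₀ two_ne_zero, mul_right_comm, ← div_eq_mul_inv]
    exact_mod_cast (Int.floor_div_natCast ((2 : ℝ) ^ k * x) 2).symm
  have h4 : ∀ x : ℝ, ⌊(4 : ℝ) ^ k * x⌋ / 4 = ⌊(4 : ℝ) ^ (k - 1) * x⌋ := fun x => by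
    rw [zpow_sub_one₀ four_ne_zero, mul_right_comm, ← div_eq_mul_inv]
    exact_mod_cast (Int.floor_div_natCast ((4 : ℝ) ^ k * x) 4).symm
  simp only [parent, PCube.ofPoint, h2, h4]

theorem k_iterate_parent (Q : PCube m) (r : ℕ) : (parent^[r] Q).k = Q.k - r := by
  induction r with
  | zero => simp
  | succ r ih => rw [Function.iterate_succ_apply', parent, ih]; push_cast; ring

theorem iterate_parent_ofPoint (k : ℤ) (p : EuclideanSpace ℝ (Fin m) × ℝ) (r : ℕ) :
    parent^[r] (PCube.ofPoint k p) = PCube.ofPoint (k - r) p := by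
  induction r with
  | zero => simp
  | succ r ih => rw [Function.iterate_succ_apply', ih, parent_ofPoint]; push_cast; congr 1; ring

theorem iterate_parent_injective (Q : PCube m) : Function.Injective fun r => parent^[r] Q := by
  intro r s h
  have := congrArg PCube.k h
  simp only [k_iterate_parent] at this
  omega

/-- The point of `Q` with smallest spatial coordinates, at relative height `s` in time. -/
noncomputable def corner (Q : PCube m) (s : ℝ) : EuclideanSpace ℝ (Fin m) × ℝ :=
  (WithLp.toLp 2 fun i => (2 : ℝ) ^ (-Q.k) * Q.v i, (4 : ℝ) ^ (-Q.k) * (Q.j + s))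

theorem corner_mem (Q : PCube m) {s : ℝ} (h0 : 0 ≤ s) (h1 : s < 1) : Q.corner s ∈ Q.carrier := by
  have h2 : (0 : ℝ) < 2 ^ (-Q.k) := by positivity
  have h4 : (0 : ℝ) < 4 ^ (-Q.k) := by positivity
  refine ⟨fun i => ⟨le_rfl, ?_⟩, ?_, ?_⟩
  · exact mul_lt_mul_of_pos_left (lt_add_one _) h2
  · exact mul_le_mul_of_nonneg_left (by linarith) h4.le
  · exact mul_lt_mul_of_pos_left (by linarith) h4

theorem k_le_of_carrier_subset {Q P : PCube m} (h : Q.carrier ⊆ P.carrier) : P.k ≤ Q.k := by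
  by_contra! hlt
  obtain ⟨hl, -⟩ := (h (Q.corner_mem le_rfl one_pos)).2
  obtain ⟨-, hu⟩ := (h (Q.corner_mem (s := 3 / 4) (by norm_num) (by norm_num))).2
  have hmono : (4 : ℝ) ^ (-P.k) ≤ 4 ^ (-Q.k - 1) := zpow_le_zpow_right₀ (by norm_num) (by omega)
  rw [zpow_sub_one₀ four_ne_zero] at hmono
  have h4 : (0 : ℝ) < 4 ^ (-Q.k) := by positivity
  simp only [corner] at hl hu
  linarith

theorem carrier_subset_iff {Q P : PCube m} :
    Q.carrier ⊆ P.carrier ↔ ∃ r : ℕ, parent^[r] Q = P := by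
  constructor
  · intro h
    have hQ := Q.corner_mem le_rfl one_pos
    refine ⟨(Q.k - P.k).toNat, ?_⟩
    rw [mem_carrier_iff.1 hQ, iterate_parent_ofPoint, mem_carrier_iff.1 (h hQ)]
    have := k_le_of_carrier_subset h
    congr 1
    simp only [PCube.ofPoint]
    omega
  · rintro ⟨r, rfl⟩ p hp
    rw [mem_carrier_iff, k_iterate_parent, ← iterate_parent_ofPoint, ← mem_carrier_iff.1 hp]

theorem carrier_injective : Function.Injective (carrier : PCube m → _) := by
  intro Q P h
  obtain ⟨r, rfl⟩ := carrier_subset_iff.1 h.subset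
  have hk := k_le_of_carrier_subset h.superset
  rw [k_iterate_parent] at hk
  obtain rfl : r = 0 := by omega
  rfl

theorem measurableSet_carrier (Q : PCube m) : MeasurableSet Q.carrier := by
  have h : Q.carrier =
      (⋂ i, (fun p : EuclideanSpace ℝ (Fin m) × ℝ => p.1 i) ⁻¹'
        Set.Ico ((2 : ℝ) ^ (-Q.k) * Q.v i) ((2 : ℝ) ^ (-Q.k) * (Q.v i + 1))) ∩
      Prod.snd ⁻¹' Set.Ico ((4 : ℝ) ^ (-Q.k) * Q.j) ((4 : ℝ) ^ (-Q.k) * (Q.j + 1)) := by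
    ext p
    simp [carrier]
  rw [h]
  refine (MeasurableSet.iInter fun i => ?_).inter (measurable_snd measurableSet_Ico)
  have hi : Measurable fun p : EuclideanSpace ℝ (Fin m) × ℝ => p.1 i := by fun_prop
  exact hi measurableSet_Ico

instance : Countable (PCube m) :=
  Function.Injective.countable (f := fun Q : PCube m => (Q.k, Q.v, Q.j))
    fun ⟨_, _, _⟩ ⟨_, _, _⟩ h => by simpa using h

/-- The children of a cube have total volume at most that of the cube. -/
theorem tsum_volume_children_le (Q : PCube m) :
    ∑' T : {T : PCube m | T.parent = Q}, volume T.1.carrier ≤ volume Q.carrier := by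
  rw [← measure_iUnion _ fun T : {T : PCube m | T.parent = Q} => T.1.measurableSet_carrier]
  · refine measure_mono (Set.iUnion_subset ?_)
    rintro ⟨T, rfl⟩
    exact carrier_subset_iff.2 ⟨1, rfl⟩
  · rintro ⟨T, hT⟩ ⟨T', hT'⟩ hne
    refine Set.disjoint_left.2 fun p hp hp' => hne (Subtype.ext ?_)
    have hk : T.k = T'.k := by
      have := congrArg PCube.k (hT.trans hT'.symm)
      simpa [parent] using this
    change p ∈ T.carrier at hp
    change p ∈ T'.carrier at hp'
    exact (mem_carrier_iff.1 hp).trans (hk ▸ (mem_carrier_iff.1 hp').symm)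

end PCube

namespace SemiCoherent

variable {m : ℕ} {S : Set (PCube m)}

theorem top_unique {Q Q' : PCube m} (h : SemiCoherent S Q) (h' : SemiCoherent S Q') : Q = Q' :=
  PCube.carrier_injective ((h'.2.1 Q h.1).antisymm (h.2.1 Q' h'.1))

end SemiCoherent

/-- The cubes of `S \ B` that are either the top cube `Qmax` or a child of a cube in `B`. -/
def restartCubes {m : ℕ} (S B : Set (PCube m)) (Qmax : PCube m) : Set (PCube m) :=
  {Q | Q ∈ S \ B ∧ (Q = Qmax ∨ Q.parent ∈ B)}

/-- The cubes of `A` whose smallest ancestor in `R` is `T`. -/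
def stoppingFamily {m : ℕ} (A R : Set (PCube m)) (T : PCube m) : Set (PCube m) :=
  {Q | Q ∈ A ∧ ∃ r : ℕ, PCube.parent^[r] Q = T ∧ ∀ i < r, PCube.parent^[i] Q ∉ R}

section Decomposition

open PCube

variable {m : ℕ} {S B : Set (PCube m)} {Qmax : PCube m}

theorem exists_restart_lt (hS : SemiCoherent S Qmax) (hB : B ⊆ S) {Q : PCube m} (hQ : Q ∈ S \ B)
    {r : ℕ} (hr : parent^[r] Q ∈ B) : ∃ i < r, parent^[i] Q ∈ restartCubes S B Qmax := by
  induction r with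
  | zero => exact absurd hr hQ.2
  | succ r ih =>
    by_cases hX : parent^[r] Q ∈ B
    · obtain ⟨i, hi, h⟩ := ih hX
      exact ⟨i, by omega, h⟩
    · rw [Function.iterate_succ_apply'] at hr
      exact ⟨r, by omega, ⟨hS.2.2 Q hQ.1 _ (hB hr) _ (carrier_subset_iff.2 ⟨r, rfl⟩)
        (carrier_subset_iff.2 ⟨1, rfl⟩), hX⟩, Or.inr hr⟩

theorem exists_restart (hS : SemiCoherent S Qmax) (hB : B ⊆ S) {Q : PCube m} (hQ : Q ∈ S \ B) :
    ∃ i, parent^[i] Q ∈ restartCubes S B Qmax := by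
  obtain ⟨r, hr⟩ := carrier_subset_iff.1 (hS.2.1 Q hQ.1)
  by_cases hmax : Qmax ∈ B
  · obtain ⟨i, -, hi⟩ := exists_restart_lt hS hB hQ (hr ▸ hmax)
    exact ⟨i, hi⟩
  · exact ⟨r, by rw [hr]; exact ⟨⟨hS.1, hmax⟩, Or.inl rfl⟩⟩

theorem semiCoherent_stoppingFamily (hS : SemiCoherent S Qmax) (hB : B ⊆ S) {T : PCube m}
    (hT : T ∈ restartCubes S B Qmax) :
    SemiCoherent (stoppingFamily (S \ B) (restartCubes S B Qmax) T) T := by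
  refine ⟨⟨hT.1, 0, rfl, by simp⟩, ?_, ?_⟩
  · rintro Q ⟨-, r, hr, -⟩
    exact carrier_subset_iff.2 ⟨r, hr⟩
  · rintro Q' ⟨hQ', d, hd, hmin⟩ Qs ⟨hQs, c, hc, -⟩ Q h1 h2
    have hQS := hS.2.2 Q' hQ'.1 Qs hQs.1 Q h1 h2
    obtain ⟨a, rfl⟩ := carrier_subset_iff.1 h1
    obtain ⟨b, rfl⟩ := carrier_subset_iff.1 h2
    simp only [← Function.iterate_add_apply] at hc
    obtain rfl : d = c + (b + a) := iterate_parent_injective Q' (hd.trans hc.symm)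
    refine ⟨⟨hQS, fun hQB => ?_⟩, c + b, ?_, fun i hi => ?_⟩
    · obtain ⟨i, hi, h⟩ := exists_restart_lt hS hB hQ' hQB
      exact hmin i (by omega) h
    · rw [← Function.iterate_add_apply, ← hd, add_assoc]
    · rw [← Function.iterate_add_apply]
      exact hmin _ (by omega)

theorem eq_of_mem_stoppingFamily {A R : Set (PCube m)} {T T' Q : PCube m} (hT : T ∈ R)
    (hT' : T' ∈ R) (h : Q ∈ stoppingFamily A R T) (h' : Q ∈ stoppingFamily A R T') : T = T' := by
  obtain ⟨-, r, rfl, hmin⟩ := h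
  obtain ⟨-, s, rfl, hmin'⟩ := h'
  obtain rfl : r = s := by
    by_contra hne
    rcases lt_or_gt_of_ne hne with hlt | hlt
    · exact hmin' r hlt hT
    · exact hmin s hlt hT'
  rfl

theorem iUnion_stoppingFamily (hS : SemiCoherent S Qmax) (hB : B ⊆ S) :
    ⋃ T ∈ restartCubes S B Qmax, stoppingFamily (S \ B) (restartCubes S B Qmax) T = S \ B := by
  classical
  refine Set.Subset.antisymm (Set.iUnion₂_subset fun T _ Q hQ => hQ.1) fun Q hQ => ?_
  have hex := exists_restart hS hB hQ
  exact Set.mem_iUnion₂.2 ⟨_, Nat.find_spec hex, hQ, _, rfl, fun i hi => Nat.find_min hex hi⟩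

theorem tsum_volume_restartCubes_le (P : PCube m) (c : ENNReal)
    (hpack : ∑' Q : {Q : PCube m // Q ∈ B ∧ Q.carrier ⊆ P.carrier}, volume Q.1.carrier ≤
      c * volume P.carrier) :
    ∑' T : {T : PCube m | T ∈ restartCubes S B Qmax ∧ T.carrier ⊆ P.carrier},
      volume T.1.carrier ≤ (2 + c) * volume P.carrier := by
  set f : PCube m → ENNReal := fun T => volume T.carrier
  set BP : Set (PCube m) := {Q | Q ∈ B ∧ Q.carrier ⊆ P.carrier}
  set M : Set (PCube m) := {Q | Q = Qmax ∧ Q.carrier ⊆ P.carrier}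
  set N : Set (PCube m) := ⋃ Q ∈ BP, {T | T.parent = Q}
  have hsub : {T : PCube m | T ∈ restartCubes S B Qmax ∧ T.carrier ⊆ P.carrier} ⊆
      ({P} ∪ M) ∪ N := by
    rintro T ⟨⟨-, hT⟩, hTP⟩
    rcases hT with hT | hT
    · exact Or.inl (Or.inr ⟨hT, hTP⟩)
    · obtain ⟨r, hr⟩ := carrier_subset_iff.1 hTP
      cases r with
      | zero => exact Or.inl (Or.inl hr)
      | succ r =>
        exact Or.inr (Set.mem_iUnion₂.2 ⟨T.parent, ⟨hT, carrier_subset_iff.2 ⟨r, hr⟩⟩, rfl⟩)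
  have hM : ∑' T : M, f T ≤ f P := by
    by_cases hmax : Qmax.carrier ⊆ P.carrier
    · refine (ENNReal.tsum_mono_subtype f (t := {Qmax}) fun T hT => hT.1).trans ?_
      rw [tsum_singleton]
      exact measure_mono hmax
    · have : IsEmpty M := ⟨fun T => hmax (T.2.1 ▸ T.2.2)⟩
      simp
  have hN : ∑' T : N, f T ≤ c * f P :=
    calc ∑' T : N, f T ≤ ∑' Q : BP, ∑' T : {T : PCube m | T.parent = Q}, f T :=
          ENNReal.tsum_biUnion_le_tsum f BP _
      _ ≤ ∑' Q : BP, f Q := ENNReal.tsum_le_tsum fun Q => tsum_volume_children_le Q.1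
      _ ≤ c * f P := hpack
  calc ∑' T : {T : PCube m | T ∈ restartCubes S B Qmax ∧ T.carrier ⊆ P.carrier}, f T
      ≤ ∑' T : ↥(({P} ∪ M) ∪ N), f T := ENNReal.tsum_mono_subtype f hsub
    _ ≤ (∑' T : ({P} : Set (PCube m)), f T + ∑' T : M, f T) + ∑' T : N, f T :=
        (ENNReal.tsum_union_le f _ _).trans (by gcongr; exact ENNReal.tsum_union_le f _ _)
    _ ≤ (f P + f P) + c * f P := by
        gcongr
        rw [tsum_singleton]
    _ = (2 + c) * f P := by ring

end Decomposition

/-- removing from a semi-coherent stopping time regime `𝐒*` a subfamily `ℬ`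
satisfying a Carleson packing condition with constant `C''`, the (nonempty) remainder
`𝐒* ∖ ℬ` partitions into countably many semi-coherent stopping time regimes whose maximal
cubes pack with constant `2 + C''`. -/
theorem statement9
    (n : ℕ) (hn : 2 ≤ n)
    (Sstar : Set (PCube (n - 1))) (Qmax : PCube (n - 1)) (hS : SemiCoherent Sstar Qmax)
    (B : Set (PCube (n - 1))) (hB : B ⊆ Sstar)
    (C'' : ℝ) (hC : 0 < C'')
    (hpack : ∀ P : PCube (n - 1),
      (∑' Q : {Q : PCube (n - 1) // Q ∈ B ∧ Q.carrier ⊆ P.carrier}, volume Q.1.carrier) ≤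
        ENNReal.ofReal C'' * volume P.carrier)
    (hne : (Sstar \ B).Nonempty) :
    ∃ (I : Set (Set (PCube (n - 1)))) (top : Set (PCube (n - 1)) → PCube (n - 1)),
      I.Countable ∧
      (I.Pairwise fun S₁ S₂ => Disjoint S₁ S₂) ∧
      (⋃ S ∈ I, S) = Sstar \ B ∧
      (∀ S ∈ I, SemiCoherent S (top S)) ∧
      ∀ P : PCube (n - 1),
        (∑' S : {S : Set (PCube (n - 1)) // S ∈ I ∧ (top S).carrier ⊆ P.carrier},
          volume (top S.1).carrier) ≤ ENNReal.ofReal (2 + C'') * volume P.carrier := by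
  classical
  set R := restartCubes Sstar B Qmax
  set F := stoppingFamily (Sstar \ B) R
  have hF : ∀ T ∈ R, SemiCoherent (F T) T := fun T hT => semiCoherent_stoppingFamily hS hB hT
  have : Nonempty (PCube (n - 1)) := ⟨Qmax⟩
  choose! top htop using fun (S : Set (PCube (n - 1))) (h : ∃ T, SemiCoherent S T) => h
  have htopF : ∀ T ∈ R, top (F T) = T := fun T hT => (htop _ ⟨T, hF T hT⟩).top_unique (hF T hT)
  refine ⟨F '' R, top, R.to_countable.image F, ?_, ?_, ?_, fun P => ?_⟩
  · rintro _ ⟨T, hT, rfl⟩ _ ⟨T', hT', rfl⟩ hne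
    refine Set.disjoint_left.2 fun Q h h' => hne ?_
    rw [eq_of_mem_stoppingFamily hT hT' h h']
  · rw [Set.biUnion_image]
    exact iUnion_stoppingFamily hS hB
  · rintro _ ⟨T, hT, rfl⟩
    exact htop _ ⟨T, hF T hT⟩
  · rw [ENNReal.ofReal_add zero_le_two hC.le, ENNReal.ofReal_ofNat]
    refine le_trans ?_ (tsum_volume_restartCubes_le (S := Sstar) (Qmax := Qmax) P _ (hpack P))
    let e : {S : Set (PCube (n - 1)) // S ∈ F '' R ∧ (top S).carrier ⊆ P.carrier} →
        {T : PCube (n - 1) | T ∈ R ∧ T.carrier ⊆ P.carrier} := fun S => ⟨top S.1, by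
      obtain ⟨T, hT, h⟩ := S.2.1
      rw [← h, htopF T hT]
      exact hT, S.2.2⟩
    have he : Function.Injective e := by
      rintro ⟨_, ⟨T, hT, rfl⟩, h⟩ ⟨_, ⟨T', hT', rfl⟩, h'⟩ heq
      have : top (F T) = top (F T') := congrArg Subtype.val heq
      rw [htopF T hT, htopF T' hT'] at this
      subst this
      rfl
    exact ENNReal.tsum_comp_le_tsum_of_injective he fun T => volume T.1.carrier
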